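/- Let (Q,P) be a weakly quasi-lattice ordered group and let Λ be a P-graph. If λ ∈ x and x ∈ PS(Λ), then the left shift λ⁻¹·x belongs to PS(Λ). -/

import Mathlib

set_option autoImplicit false

/-- The topology on the power set `Set α` obtained by identifying it with the
product `∏ _ : α, Prop` where each (two-point) factor `Prop` carries the
discrete topology. -/
instance powersetTopology (α : Type) : TopologicalSpace (Set α) :=
  @Pi.topologicalSpace α (fun _ => Prop) (fun _ => ⊥)

/-- The cylinder `Z(K₁;K₂) = {x : K₁ ⊆ x ⊆ K₂ᶜ}`. -/
def cylinder {α : Type} (K₁ K₂ : Set α) : Set (Set α) :=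
  {x | K₁ ⊆ x ∧ x ⊆ K₂ᶜ}

/-- The relation `p ≤ r` iff `p * q = r` for some `q ∈ P`. -/
def Submonoid.leftLE {Q : Type} [Group Q] (P : Submonoid Q) (p r : Q) : Prop :=
  ∃ q ∈ P, p * q = r

/-- A weakly quasi-lattice ordered group `(Q,P)`: a group `Q` together with a
subsemigroup `P` containing the unit with `P ∩ P⁻¹ = {e}`, such that any two
elements of `P` with a common upper bound (for `leftLE`) have a least common
upper bound. -/
structure WQLO (Q : Type) [Group Q] where
  P : Submonoid Q
  inter_inv : ∀ p ∈ P, p⁻¹ ∈ P → p = 1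
  lub : ∀ a ∈ P, ∀ b ∈ P, (∃ c ∈ P, P.leftLE a c ∧ P.leftLE b c) →
    ∃ l ∈ P, P.leftLE a l ∧ P.leftLE b l ∧
      ∀ c ∈ P, P.leftLE a c → P.leftLE b c → P.leftLE l c

/-- A (discrete) `P`-graph: a countable small category, presented by its set of
morphisms `Λ` with range map `r`, source map `s` and a composition `mul`
(constrained by the axioms only on composable pairs, i.e. when `s μ = r ν`),
together with a degree functor `d : Λ → P` satisfying the unique factorisation
property. The units of `Λ` are exactly the elements of the form `r lam`. -/
structure PGraph (Q : Type) [Group Q] (W : WQLO Q) where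
  Λ : Type
  countable : Countable Λ
  r : Λ → Λ
  s : Λ → Λ
  mul : Λ → Λ → Λ
  d : Λ → Q
  d_mem : ∀ lam, d lam ∈ W.P
  s_r : ∀ lam, s (r lam) = r lam
  r_r : ∀ lam, r (r lam) = r lam
  s_s : ∀ lam, s (s lam) = s lam
  r_s : ∀ lam, r (s lam) = s lam
  id_mul : ∀ lam, mul (r lam) lam = lam
  mul_id : ∀ lam, mul lam (s lam) = lam
  r_mul : ∀ mu nu, s mu = r nu → r (mul mu nu) = r mu
  s_mul : ∀ mu nu, s mu = r nu → s (mul mu nu) = s nu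
  mul_assoc : ∀ mu nu k, s mu = r nu → s nu = r k →
    mul (mul mu nu) k = mul mu (mul nu k)
  d_unit : ∀ lam, d (r lam) = 1
  d_mul : ∀ mu nu, s mu = r nu → d (mul mu nu) = d mu * d nu
  factor : ∀ lam, ∀ p ∈ W.P, ∀ q ∈ W.P, d lam = p * q →
    ∃! mn : Λ × Λ, s mn.1 = r mn.2 ∧ mul mn.1 mn.2 = lam ∧ d mn.1 = p ∧ d mn.2 = q

namespace PGraph

variable {Q : Type} [Group Q] {W : WQLO Q} (G : PGraph Q W)

/-- `λΛ = {λμ : μ ∈ Λ, s λ = r μ}`. -/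
def cone (lam : G.Λ) : Set G.Λ :=
  {x | ∃ mu, G.s lam = G.r mu ∧ x = G.mul lam mu}

/-- `λE = {λμ : μ ∈ E, s λ = r μ}`. -/
def coneSet (lam : G.Λ) (E : Set G.Λ) : Set G.Λ :=
  {x | ∃ mu ∈ E, G.s lam = G.r mu ∧ x = G.mul lam mu}

/-- `Λ` is finitely aligned at the pair `(μ,ν)`. -/
def FinAlignedAtPair (mu nu : G.Λ) : Prop :=
  ∃ J : Finset G.Λ, G.cone mu ∩ G.cone nu = ⋃ lam ∈ (J : Set G.Λ), G.cone lam

/-- `Λ` is finitely aligned at `λ`. -/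
def FinAlignedAt (lam : G.Λ) : Prop :=
  ∀ mu ∈ G.cone lam, ∀ nu : G.Λ, G.FinAlignedAtPair mu nu

/-- The finitely aligned part `FA(Λ)`. -/
def FA : Set G.Λ := {lam | G.FinAlignedAt lam}

/-- `FAr(Λ) = FA(Λ) ∪ r(FA(Λ))`. -/
def FAr : Set G.Λ := G.FA ∪ G.r '' G.FA

/-- `μ ≼ λ` iff `μν = λ` for some `ν`. -/
def pre (mu lam : G.Λ) : Prop :=
  ∃ nu, G.s mu = G.r nu ∧ G.mul mu nu = lam

/-- A filter: a nonempty, hereditary and directed subset of `Λ`. -/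
def IsFilter (x : Set G.Λ) : Prop :=
  x.Nonempty ∧ (∀ lam mu, G.pre lam mu → mu ∈ x → lam ∈ x) ∧
    ∀ mu ∈ x, ∀ nu ∈ x, ∃ lam ∈ x, G.pre mu lam ∧ G.pre nu lam

/-- The space `ℱΛ` of filters, with the subspace topology from `𝒫(Λ)`. -/
abbrev FilterSpace := {x : Set G.Λ // G.IsFilter x}

/-- `Z_{ℱΛ}(μ;K) = {x ∈ ℱΛ : μ ∈ x ⊆ Λ∖K}`. -/
def Zf (mu : G.Λ) (K : Set G.Λ) : Set G.FilterSpace :=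
  {x | mu ∈ x.1 ∧ x.1 ⊆ Kᶜ}

/-- An ultrafilter: a filter maximal with respect to inclusion. -/
def IsUltrafilter (x : Set G.Λ) : Prop :=
  G.IsFilter x ∧ ∀ y, G.IsFilter y → x ⊆ y → x = y

/-- The path space `PS(Λ)`: filters meeting `FA(Λ)` (as a set of subsets). -/
def PS : Set (Set G.Λ) := {x | G.IsFilter x ∧ (x ∩ G.FA).Nonempty}

/-- The path space as a topological space (subspace of `𝒫(Λ)`). -/
abbrev PSpace := {x : Set G.Λ // x ∈ G.PS}

/-- The boundary-path space: the closure in `PS(Λ)` of the set of ultrafilters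
lying in `PS(Λ)`. -/
def BPS : Set G.PSpace := closure {x : G.PSpace | G.IsUltrafilter x.1}

abbrev BPSpace := {x : G.PSpace // x ∈ G.BPS}

/-- The left shift `λ⁻¹·x = {μ : λμ ∈ x}`. -/
def lshift (lam : G.Λ) (x : Set G.Λ) : Set G.Λ :=
  {mu | G.s lam = G.r mu ∧ G.mul lam mu ∈ x}

/-- The right shift `λ·x = {ζ : ζ ≼ λμ for some μ ∈ x}`. -/
def rshift (lam : G.Λ) (x : Set G.Λ) : Set G.Λ :=
  {z | ∃ mu ∈ x, G.s lam = G.r mu ∧ G.pre z (G.mul lam mu)}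

/-- The action `x·m`: the left shift of `x` by the unique element of
`x ∩ Λ^m` (when it exists). -/
def act (x : Set G.Λ) (m : Q) : Set G.Λ :=
  ⋃ lam ∈ {l ∈ x | G.d l = m}, G.lshift lam x

/-- The domain `D_m = {x ∈ PS(Λ) : x ∩ Λ^m ≠ ∅}` of `T_m`. -/
def Dom (m : Q) : Set (Set G.Λ) := {x ∈ G.PS | ∃ l ∈ x, G.d l = m}

/-- The range `R_m = {x·m : x ∈ D_m}` of `T_m`. -/
def Ran (m : Q) : Set (Set G.Λ) := {y | ∃ x ∈ G.Dom m, G.act x m = y}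

end PGraph

namespace PGraph

variable {Q : Type} [Group Q] {W : WQLO Q} (G : PGraph Q W)

theorem mul_left_cancel {lam mu nu : G.Λ} (hmu : G.s lam = G.r mu) (hnu : G.s lam = G.r nu)
    (h : G.mul lam mu = G.mul lam nu) : mu = nu := by
  have hd : G.d mu = G.d nu := by
    have h' := congrArg G.d h
    rwa [G.d_mul _ _ hmu, G.d_mul _ _ hnu, mul_right_inj] at h'
  have hpair := (G.factor (G.mul lam mu) _ (G.d_mem lam) _ (G.d_mem mu) (G.d_mul _ _ hmu)).unique
    (y₁ := (lam, mu)) (y₂ := (lam, nu)) ⟨hmu, rfl, rfl, rfl⟩ ⟨hnu, h.symm, rfl, hd.symm⟩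
  exact congrArg Prod.snd hpair

theorem pre_iff_mem_cone {mu lam : G.Λ} : G.pre mu lam ↔ lam ∈ G.cone mu := by
  simp only [pre, cone, Set.mem_ofPred_eq, eq_comm]

theorem r_eq_of_mem_cone {mu lam : G.Λ} (h : lam ∈ G.cone mu) : G.r lam = G.r mu := by
  obtain ⟨nu, hnu, rfl⟩ := h
  exact G.r_mul _ _ hnu

theorem mem_cone_self (lam : G.Λ) : lam ∈ G.cone lam :=
  ⟨G.s lam, (G.r_s lam).symm, (G.mul_id lam).symm⟩

theorem mem_cone_trans {lam mu nu : G.Λ} (h : nu ∈ G.cone mu) (h' : mu ∈ G.cone lam) :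
    nu ∈ G.cone lam := by
  obtain ⟨a, ha, rfl⟩ := h'
  obtain ⟨b, hb, rfl⟩ := h
  rw [G.s_mul _ _ ha] at hb
  exact ⟨G.mul a b, by rw [G.r_mul _ _ hb, ha], G.mul_assoc _ _ _ ha hb⟩

theorem mul_mem_cone_mul_iff {lam mu nu : G.Λ} (hmu : G.s lam = G.r mu)
    (hnu : G.s lam = G.r nu) : G.mul lam nu ∈ G.cone (G.mul lam mu) ↔ nu ∈ G.cone mu := by
  constructor
  · rintro ⟨a, ha, h⟩
    rw [G.s_mul _ _ hmu] at ha
    rw [G.mul_assoc _ _ _ hmu ha] at h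
    exact ⟨a, ha, G.mul_left_cancel hnu (by rw [G.r_mul _ _ ha, hmu]) h⟩
  · rintro ⟨a, ha, rfl⟩
    exact ⟨a, by rw [G.s_mul _ _ hmu, ha], (G.mul_assoc _ _ _ hmu ha).symm⟩

theorem exists_mul_of_mem_cone_mul {lam mu nu : G.Λ} (hmu : G.s lam = G.r mu)
    (h : nu ∈ G.cone (G.mul lam mu)) : ∃ k, G.s lam = G.r k ∧ nu = G.mul lam k :=
  G.mem_cone_trans h ⟨mu, hmu, rfl⟩

theorem FinAlignedAt.of_mem_cone {lam mu : G.Λ} (h : G.FinAlignedAt lam) (hmu : mu ∈ G.cone lam) :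
    G.FinAlignedAt mu :=
  fun _ ha nu => h _ (G.mem_cone_trans ha hmu) nu

theorem FinAlignedAtPair.of_mul {lam mu nu : G.Λ} (hmu : G.s lam = G.r mu)
    (hnu : G.s lam = G.r nu) (h : G.FinAlignedAtPair (G.mul lam mu) (G.mul lam nu)) :
    G.FinAlignedAtPair mu nu := by
  obtain ⟨J, hJ⟩ := h
  have hfin : {k | G.s lam = G.r k ∧ G.mul lam k ∈ J}.Finite :=
    Set.Finite.of_finite_image (J.finite_toSet.subset (by rintro _ ⟨k, hk, rfl⟩; exact hk.2))
      fun a ha b hb hab => G.mul_left_cancel ha.1 hb.1 hab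
  refine ⟨hfin.toFinset, Set.ext fun z => ?_⟩
  have hmem : ∀ {w}, w ∈ G.cone (G.mul lam mu) ∩ G.cone (G.mul lam nu) ↔
      ∃ j ∈ J, w ∈ G.cone j := by
    intro w
    rw [hJ]
    simp
  simp only [Set.Finite.coe_toFinset, Set.mem_iUnion, Set.mem_ofPred_eq, exists_prop]
  constructor
  · rintro ⟨hz, hz'⟩
    have hr : G.s lam = G.r z := by rw [G.r_eq_of_mem_cone hz, hmu]
    obtain ⟨j, hj, hzj⟩ := hmem.1
      ⟨(G.mul_mem_cone_mul_iff hmu hr).2 hz, (G.mul_mem_cone_mul_iff hnu hr).2 hz'⟩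
    obtain ⟨k, hk, rfl⟩ := G.exists_mul_of_mem_cone_mul hmu (hmem.2 ⟨j, hj, G.mem_cone_self j⟩).1
    exact ⟨k, ⟨hk, hj⟩, (G.mul_mem_cone_mul_iff hk hr).1 hzj⟩
  · rintro ⟨k, ⟨hk, hj⟩, hz⟩
    have hr : G.s lam = G.r z := by rw [G.r_eq_of_mem_cone hz, hk]
    have hw := hmem.2 ⟨_, hj, (G.mul_mem_cone_mul_iff hk hr).2 hz⟩
    exact ⟨(G.mul_mem_cone_mul_iff hmu hr).1 hw.1, (G.mul_mem_cone_mul_iff hnu hr).1 hw.2⟩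

theorem finAlignedAtPair_of_r_ne {mu nu : G.Λ} (h : G.r mu ≠ G.r nu) :
    G.FinAlignedAtPair mu nu := by
  refine ⟨∅, Set.ext fun z => ?_⟩
  simp only [Finset.coe_empty, Set.mem_empty_iff_false, Set.iUnion_of_empty, Set.iUnion_empty,
    iff_false]
  exact fun hz => h ((G.r_eq_of_mem_cone hz.1).symm.trans (G.r_eq_of_mem_cone hz.2))

theorem FinAlignedAt.of_mul {lam mu : G.Λ} (hmu : G.s lam = G.r mu)
    (h : G.FinAlignedAt (G.mul lam mu)) : G.FinAlignedAt mu := by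
  intro a ha nu
  have hr : G.s lam = G.r a := by rw [G.r_eq_of_mem_cone ha, hmu]
  by_cases hnu : G.r a = G.r nu
  · exact FinAlignedAtPair.of_mul G hr (hr.trans hnu)
      (h _ ((G.mul_mem_cone_mul_iff hmu hr).2 ha) _)
  · exact G.finAlignedAtPair_of_r_ne hnu

theorem IsFilter.lshift {lam : G.Λ} {x : Set G.Λ} (hx : G.IsFilter x) (hl : lam ∈ x) :
    G.IsFilter (G.lshift lam x) := by
  obtain ⟨-, hher, hdir⟩ := hx
  simp only [pre_iff_mem_cone] at hher hdir
  refine ⟨⟨G.s lam, (G.r_s lam).symm, by rwa [G.mul_id]⟩, ?_, ?_⟩ <;>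
    simp only [pre_iff_mem_cone]
  · rintro a b hab ⟨hb, hbx⟩
    have ha : G.s lam = G.r a := by rw [hb, G.r_eq_of_mem_cone hab]
    exact ⟨ha, hher _ _ ((G.mul_mem_cone_mul_iff ha hb).2 hab) hbx⟩
  · rintro a ⟨ha, hax⟩ b ⟨hb, hbx⟩
    obtain ⟨c, hc, hac, hbc⟩ := hdir _ hax _ hbx
    obtain ⟨k, hk, rfl⟩ := G.exists_mul_of_mem_cone_mul ha hac
    exact ⟨k, ⟨hk, hc⟩, (G.mul_mem_cone_mul_iff ha hk).1 hac, (G.mul_mem_cone_mul_iff hb hk).1 hbc⟩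

end PGraph

/-- If `λ ∈ x` and `x ∈ PS(Λ)` then the left shift `λ⁻¹·x` belongs to
`PS(Λ)`. -/
theorem statement11 {Q : Type} [Group Q] {W : WQLO Q} (G : PGraph Q W)
    (lam : G.Λ) (x : Set G.Λ) (hx : x ∈ G.PS) (hl : lam ∈ x) :
    G.lshift lam x ∈ G.PS := by
  obtain ⟨hf, k, hkx, hk⟩ := hx
  refine ⟨PGraph.IsFilter.lshift G hf hl, ?_⟩
  obtain ⟨_, hx', ⟨mu, hmu, rfl⟩, hke⟩ := hf.2.2 _ hl _ hkx
  exact ⟨mu, ⟨hmu, hx'⟩, PGraph.FinAlignedAt.of_mul G hmu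
    (PGraph.FinAlignedAt.of_mem_cone G hk (G.pre_iff_mem_cone.1 hke))⟩
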